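/- Fix 0 ≤ p < 1. Let Rp : ℕ → ℝ satisfy Rp(0) = 0 and, for all n ≥ 1, Rp(n) = 1 + p·Rp(n−1) + ((1−p)/H_n)·Σ_{k=1}^{n−1} Rp(k)/(n − k). Then for all n ≥ 40, ((400/3447)/(1 − (1808/1915)·p))·H_n² ≤ Rp(n) ≤ ((5/7)/(1−p))·H_n². -/

import Mathlib

open Finset

/-- The `n`-th harmonic number `H_n = ∑_{k=1}^n 1/k`, with `H 0 = 0`. -/
noncomputable def H (n : ℕ) : ℝ := ∑ k ∈ Finset.Icc 1 n, (1 : ℝ) / k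

/-- The second-order harmonic number `∑_{k=1}^n 1/k²`. -/
noncomputable def H₂ (n : ℕ) : ℝ := ∑ k ∈ Finset.Icc 1 n, (1 : ℝ) / (k : ℝ) ^ 2

theorem H_zero : H 0 = 0 := by simp [H]

theorem H_succ (n : ℕ) : H (n + 1) = H n + 1 / ((n : ℝ) + 1) := by
  simp [H, Finset.sum_Icc_succ_top]

theorem H₂_succ (n : ℕ) : H₂ (n + 1) = H₂ n + 1 / ((n : ℝ) + 1) ^ 2 := by
  simp [H₂, Finset.sum_Icc_succ_top]

theorem H_mono : Monotone H := monotone_nat_of_le_succ fun n => by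
  rw [H_succ]
  have : (0 : ℝ) < 1 / ((n : ℝ) + 1) := by positivity
  linarith

theorem H₂_mono : Monotone H₂ := monotone_nat_of_le_succ fun n => by
  rw [H₂_succ]
  have : (0 : ℝ) < 1 / ((n : ℝ) + 1) ^ 2 := by positivity
  linarith

theorem H_nonneg (n : ℕ) : 0 ≤ H n := H_zero ▸ H_mono n.zero_le

theorem one_le_H_succ (n : ℕ) : 1 ≤ H (n + 1) := by
  have h := H_mono (Nat.le_add_left 1 n)
  have h1 : H 1 = 1 := by simp [H]
  linarith

theorem H₂_succ_le (n : ℕ) : H₂ (n + 1) ≤ 2 - 1 / ((n : ℝ) + 1) := by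
  induction n with
  | zero => norm_num [H₂]
  | succ n ih =>
    rw [H₂_succ]
    push_cast
    have key : 1 / ((n : ℝ) + 1 + 1) ^ 2 ≤ 1 / ((n : ℝ) + 1) - 1 / ((n : ℝ) + 1 + 1) := by
      rw [div_sub_div _ _ (by positivity) (by positivity),
        div_le_div_iff₀ (by positivity) (by positivity)]
      nlinarith [(n.cast_nonneg : (0 : ℝ) ≤ n)]
    linarith

theorem sum_reflect (f g : ℕ → ℝ) (m : ℕ) :
    ∑ k ∈ Finset.Icc 1 m, f k * g (m + 1 - k) = ∑ k ∈ Finset.Icc 1 m, f (m + 1 - k) * g k := by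
  refine Finset.sum_nbij' (fun k => m + 1 - k) (fun k => m + 1 - k) ?_ ?_ ?_ ?_ ?_ <;>
    intro k hk <;> simp only [Finset.mem_Icc] at hk ⊢
  · omega
  · omega
  · omega
  · omega
  · rw [show m + 1 - (m + 1 - k) = k by omega]

theorem sum_one_div_sub (m : ℕ) :
    ∑ k ∈ Finset.Icc 1 m, 1 / ((m : ℝ) + 1 - k) = H m := by
  have h := sum_reflect (fun _ => 1) (fun k => 1 / (k : ℝ)) m
  simp only [one_mul] at h
  rw [H, ← h]
  refine Finset.sum_congr rfl fun k hk => ?_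
  rw [Nat.cast_sub (by have := (Finset.mem_Icc.1 hk).2; omega)]
  push_cast
  rfl

theorem sum_id_div_sub (m : ℕ) :
    ∑ k ∈ Finset.Icc 1 m, (k : ℝ) / ((m : ℝ) + 1 - k) = ((m : ℝ) + 1) * H m - m := by
  have h : ∀ k ∈ Finset.Icc 1 m, (k : ℝ) / ((m : ℝ) + 1 - k)
      = ((m : ℝ) + 1) * (1 / ((m : ℝ) + 1 - k)) - 1 := by
    intro k hk
    have hk' : (k : ℝ) ≤ m := by exact_mod_cast (Finset.mem_Icc.1 hk).2
    have : (m : ℝ) + 1 - k ≠ 0 := by linarith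
    field_simp
    ring
  rw [Finset.sum_congr rfl h, Finset.sum_sub_distrib, ← Finset.mul_sum, sum_one_div_sub]
  simp

theorem sum_H_reflect (m : ℕ) :
    ∑ k ∈ Finset.Icc 1 m, H (m + 1 - k) * (1 / (k : ℝ)) = H (m + 1) ^ 2 - H₂ (m + 1) := by
  induction m with
  | zero => simp [H, H₂]
  | succ m ih =>
    have h : ∀ k ∈ Finset.Icc 1 (m + 1), H (m + 1 + 1 - k) * (1 / (k : ℝ))
        = H (m + 1 - k) * (1 / (k : ℝ))
          + (1 / ((m : ℝ) + 2)) * (1 / (k : ℝ) + 1 / (((m + 1 : ℕ) : ℝ) + 1 - k)) := by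
      intro k hk
      obtain ⟨hk1, hk2⟩ := Finset.mem_Icc.1 hk
      have hk1' : (1 : ℝ) ≤ k := by exact_mod_cast hk1
      have hk2' : (k : ℝ) ≤ m + 1 := by exact_mod_cast hk2
      rw [show m + 1 + 1 - k = (m + 1 - k) + 1 by omega, H_succ, Nat.cast_sub hk2]
      push_cast
      have h1 : (k : ℝ) ≠ 0 := by linarith
      have h2 : (m : ℝ) + 1 - k + 1 ≠ 0 := by linarith
      have h3 : (m : ℝ) + 1 + 1 - k ≠ 0 := by linarith
      field_simp
      ring
    rw [Finset.sum_congr rfl h, Finset.sum_add_distrib, ← Finset.mul_sum,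
      Finset.sum_add_distrib, sum_one_div_sub, Finset.sum_Icc_succ_top (by omega), ih,
      Nat.sub_self, H_zero, show ∑ k ∈ Finset.Icc 1 (m + 1), 1 / (k : ℝ) = H (m + 1) from rfl,
      H_succ (m + 1), H₂_succ (m + 1)]
    push_cast
    field_simp
    ring

theorem sum_H_div_sub (m : ℕ) :
    ∑ k ∈ Finset.Icc 1 m, H k / ((m : ℝ) + 1 - k) = H (m + 1) ^ 2 - H₂ (m + 1) := by
  rw [← sum_H_reflect, ← sum_reflect H (fun k => 1 / (k : ℝ))]
  refine Finset.sum_congr rfl fun k hk => ?_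
  rw [Nat.cast_sub (by have := (Finset.mem_Icc.1 hk).2; omega)]
  push_cast
  rw [mul_one_div]

theorem sum_div_sub_le_sum_div_sub {f g : ℕ → ℝ} {m : ℕ}
    (h : ∀ k, 1 ≤ k → k ≤ m → f k ≤ g k) :
    ∑ k ∈ Finset.Icc 1 m, f k / ((m : ℝ) + 1 - k)
      ≤ ∑ k ∈ Finset.Icc 1 m, g k / ((m : ℝ) + 1 - k) := by
  refine Finset.sum_le_sum fun k hk => ?_
  obtain ⟨hk1, hk2⟩ := Finset.mem_Icc.1 hk
  have hk' : (k : ℝ) ≤ m := by exact_mod_cast hk2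
  exact div_le_div_of_nonneg_right (h k hk1 hk2) (by linarith)

theorem sum_affine_H_div_sub (a b : ℝ) (m : ℕ) :
    ∑ k ∈ Finset.Icc 1 m, (a * H k + b) / ((m : ℝ) + 1 - k)
      = a * (H (m + 1) ^ 2 - H₂ (m + 1)) + b * H m := by
  rw [← sum_H_div_sub, ← sum_one_div_sub, Finset.mul_sum, Finset.mul_sum,
    ← Finset.sum_add_distrib]
  exact Finset.sum_congr rfl fun k _ => by ring

theorem antitone_H_succ_div : Antitone fun n : ℕ => H (n + 1) / ((n : ℝ) + 1) :=
  antitone_nat_of_succ_le fun n => by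
    rw [H_succ (n + 1)]
    push_cast
    have h := one_le_H_succ n
    have hn : (0 : ℝ) ≤ n := n.cast_nonneg
    rw [div_le_div_iff₀ (by positivity) (by positivity)]
    have : 1 / ((n : ℝ) + 1 + 1) * ((n : ℝ) + 1) ≤ 1 := by
      rw [one_div_mul_eq_div, div_le_one (by positivity)]
      linarith
    nlinarith

theorem H_forty_bounds : 427 / 100 ≤ H 40 ∧ H 40 ≤ 428 / 100 := by
  constructor <;> norm_num [H, Finset.sum_Icc_succ_top]

theorem H_sq_le (n : ℕ) (hn : 40 ≤ n) : H n ^ 2 ≤ 48 / 100 * n := by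
  induction n, hn using Nat.le_induction with
  | base =>
    have := H_forty_bounds
    push_cast
    nlinarith
  | succ n hn ih =>
    have hn' : (40 : ℝ) ≤ n := by exact_mod_cast hn
    have hH := H_nonneg n
    have hle : H n ≤ 12 / 100 * ((n : ℝ) + 1) := by nlinarith
    rw [H_succ]
    push_cast
    set x : ℝ := 1 / ((n : ℝ) + 1) with hx
    have hx0 : 0 ≤ x := by positivity
    have hx1 : x ≤ 1 / 40 := by
      rw [hx]
      exact one_div_le_one_div_of_le (by norm_num) (by linarith)
    have hHx : H n * x ≤ 12 / 100 := by
      rw [hx, mul_one_div, div_le_iff₀ (by positivity)]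
      exact hle
    nlinarith

theorem three_halves_le_H₂_add (m : ℕ) :
    3 / 2 ≤ H₂ (m + 1) + 6 / 5 / (((m : ℝ) + 1) * H (m + 1)) := by
  rcases le_or_gt 6 m with hm | hm
  · have h7 : 3 / 2 ≤ H₂ 7 := by norm_num [H₂, Finset.sum_Icc_succ_top]
    have h := H₂_mono (show 7 ≤ m + 1 by omega)
    have h0 : 0 ≤ 6 / 5 / (((m : ℝ) + 1) * H (m + 1)) :=
      div_nonneg (by norm_num) (mul_nonneg (by positivity) (H_nonneg _))
    linarith
  · interval_cases m <;> norm_num [H, H₂, Finset.sum_Icc_succ_top]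

section Recurrence

variable {p : ℝ} {Rp : ℕ → ℝ}

theorem upper_bound_aux (hp0 : 0 ≤ p) (hp1 : p < 1) (hRp0 : Rp 0 = 0)
    (hrec : ∀ m : ℕ, Rp (m + 1) = 1 + p * Rp m +
      ((1 - p) / H (m + 1)) * ∑ k ∈ Finset.Icc 1 m, Rp k / ((m : ℝ) + 1 - k)) (n : ℕ) :
    Rp n ≤ 2 / 3 / (1 - p) * (H n ^ 2 + 6 / 5) := by
  have hq : 0 < 1 - p := by linarith
  set c : ℝ := 2 / 3 / (1 - p) with hc
  have hc0 : 0 < c := by positivity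
  have hcq : (1 - p) * c = 2 / 3 := by rw [hc]; field_simp
  induction n using Nat.strong_induction_on with
  | _ n ih =>
  rcases n with _ | m
  · rw [hRp0]; positivity
  have h1 := one_le_H_succ m
  have hh : 0 < H (m + 1) := by linarith
  have hsum : ∑ k ∈ Finset.Icc 1 m, Rp k / ((m : ℝ) + 1 - k)
      ≤ c * H (m + 1) * (H (m + 1) ^ 2 - H₂ (m + 1)) + c * (6 / 5) * H m := by
    rw [← sum_affine_H_div_sub]
    refine sum_div_sub_le_sum_div_sub fun k _ hk => (ih k (by omega)).trans ?_
    have h2 := H_mono (show k ≤ m + 1 by omega)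
    have h3 := mul_le_mul_of_nonneg_left h2 (H_nonneg k)
    nlinarith
  have hprev : Rp m ≤ c * (H (m + 1) ^ 2 + 6 / 5) := by
    refine (ih m (by omega)).trans ?_
    have := pow_le_pow_left₀ (H_nonneg m) (H_mono (Nat.le_succ m)) 2
    gcongr
  have hsum' := mul_le_mul_of_nonneg_left hsum (show 0 ≤ (1 - p) / H (m + 1) by positivity)
  have hprev' := mul_le_mul_of_nonneg_left hprev hp0
  have heq : (1 - p) / H (m + 1) *
      (c * H (m + 1) * (H (m + 1) ^ 2 - H₂ (m + 1)) + c * (6 / 5) * H m)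
      = ((1 - p) * c) * (H (m + 1) ^ 2 + 6 / 5
        - (H₂ (m + 1) + 6 / 5 / (((m : ℝ) + 1) * H (m + 1)))) := by
    rw [show H m = H (m + 1) - 1 / ((m : ℝ) + 1) by rw [H_succ]; ring]
    field_simp
    ring
  have hkey := three_halves_le_H₂_add m
  rw [heq, hcq] at hsum'
  rw [hrec m]
  have hG : c * (H (m + 1) ^ 2 + 6 / 5) = p * (c * (H (m + 1) ^ 2 + 6 / 5))
      + 2 / 3 * (H (m + 1) ^ 2 + 6 / 5) := by
    rw [← hcq]; ring
  linarith

theorem linear_lower_bound (hp0 : 0 ≤ p) (hp1 : p < 1) (hRp0 : Rp 0 = 0)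
    (hrec : ∀ m : ℕ, Rp (m + 1) = 1 + p * Rp m +
      ((1 - p) / H (m + 1)) * ∑ k ∈ Finset.Icc 1 m, Rp k / ((m : ℝ) + 1 - k))
    {a : ℝ} {N : ℕ}
    (haN : ∀ m < N, a * (p + (1 - p) * (((m : ℝ) + 1) / H (m + 1))) ≤ 1)
    (n : ℕ) (hn : n ≤ N) : a * n ≤ Rp n := by
  have hq : 0 < 1 - p := by linarith
  induction n using Nat.strong_induction_on with
  | _ n ih =>
  rcases n with _ | m
  · simp [hRp0]
  have hh : 0 < H (m + 1) := by linarith [one_le_H_succ m]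
  have hsum : a * (((m : ℝ) + 1) * H m - m)
      ≤ ∑ k ∈ Finset.Icc 1 m, Rp k / ((m : ℝ) + 1 - k) := by
    rw [← sum_id_div_sub, Finset.mul_sum]
    simp only [← mul_div_assoc]
    exact sum_div_sub_le_sum_div_sub fun k _ hk => ih k (by omega) (by omega)
  have hsum' := mul_le_mul_of_nonneg_left hsum (show 0 ≤ (1 - p) / H (m + 1) by positivity)
  have hprev := mul_le_mul_of_nonneg_left (ih m (by omega) (by omega)) hp0
  have heq : (1 - p) / H (m + 1) * (a * (((m : ℝ) + 1) * H m - m))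
      = (1 - p) * a * ((m : ℝ) + 1) - a * ((1 - p) * (((m : ℝ) + 1) / H (m + 1))) := by
    rw [show H m = H (m + 1) - 1 / ((m : ℝ) + 1) by rw [H_succ]; ring]
    field_simp
    ring
  have hkey := haN m (by omega)
  rw [heq] at hsum'
  rw [hrec m]
  push_cast
  linarith

theorem harmonic_mean_le (hp0 : 0 ≤ p) (hp1 : p < 1) (hRp0 : Rp 0 = 0)
    (hrec : ∀ m : ℕ, Rp (m + 1) = 1 + p * Rp m +
      ((1 - p) / H (m + 1)) * ∑ k ∈ Finset.Icc 1 m, Rp k / ((m : ℝ) + 1 - k)) (n : ℕ) :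
    1 / (p / ((n : ℝ) + 1) + (1 - p) / H (n + 1)) ≤ Rp (n + 1) := by
  have hq : 0 < 1 - p := by linarith
  have hh : 0 < H (n + 1) := by linarith [one_le_H_succ n]
  have hd : 0 < p + (1 - p) * (((n : ℝ) + 1) / H (n + 1)) := by positivity
  have h := linear_lower_bound hp0 hp1 hRp0 hrec
    (a := 1 / (p + (1 - p) * (((n : ℝ) + 1) / H (n + 1)))) (N := n + 1)
    (fun m hm => by
      have hm' : 0 < H (m + 1) := by linarith [one_le_H_succ m]
      rw [one_div_mul_eq_div, div_le_one hd]
      have h2 := antitone_H_succ_div (show m ≤ n by omega)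
      have h3 : ((m : ℝ) + 1) / H (m + 1) ≤ ((n : ℝ) + 1) / H (n + 1) := by
        rw [← inv_div, ← inv_div (H (n + 1))]
        exact inv_anti₀ (by positivity) h2
      gcongr) (n + 1) le_rfl
  refine le_trans (le_of_eq ?_) h
  push_cast
  field_simp

theorem lower_bound_aux (hp0 : 0 ≤ p) (hp1 : p < 1) (hRp0 : Rp 0 = 0)
    (hrec : ∀ m : ℕ, Rp (m + 1) = 1 + p * Rp m +
      ((1 - p) / H (m + 1)) * ∑ k ∈ Finset.Icc 1 m, Rp k / ((m : ℝ) + 1 - k))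
    {c : ℝ} (hc0 : 0 < c) (hc : c * (861 / 100 * (1 - p) + 48 / 100 * p) ≤ 1)
    (n : ℕ) (hn : 40 ≤ n) : c * H n ^ 2 ≤ Rp n := by
  have hq : 0 < 1 - p := by linarith
  induction n using Nat.strong_induction_on with
  | _ n ih =>
  rcases n with _ | m
  · omega
  have h1 := one_le_H_succ m
  have hh : 0 < H (m + 1) := by linarith
  have hsq := H_sq_le (m + 1) hn
  push_cast at hsq
  have hm : (39 : ℝ) ≤ m := by exact_mod_cast (show 39 ≤ m by omega)
  rcases le_or_gt (H (m + 1)) (861 / 100) with hle | hgt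
  · refine le_trans ?_ (harmonic_mean_le hp0 hp1 hRp0 hrec m)
    rw [le_div_iff₀ (by positivity)]
    refine le_trans ?_ hc
    rw [mul_assoc]
    refine mul_le_mul_of_nonneg_left ?_ hc0.le
    have e : H (m + 1) ^ 2 * (p / ((m : ℝ) + 1) + (1 - p) / H (m + 1))
        = H (m + 1) * (1 - p) + H (m + 1) ^ 2 / ((m : ℝ) + 1) * p := by
      field_simp
      ring
    rw [e]
    have h2 : H (m + 1) ^ 2 / ((m : ℝ) + 1) ≤ 48 / 100 := by
      rwa [div_le_iff₀ (by positivity)]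
    gcongr
  · have hm40 : 40 ≤ m := by
      by_contra hcon
      have := H_mono (show m + 1 ≤ 40 by omega)
      linarith [H_forty_bounds.2]
    have hnonneg : ∀ k, 0 ≤ Rp k := fun k => by
      rcases k with _ | k
      · exact hRp0.ge
      have := one_le_H_succ k
      refine le_trans ?_ (harmonic_mean_le hp0 hp1 hRp0 hrec k)
      positivity
    have hsum : 2 * c * H (m + 1) * (H (m + 1) ^ 2 - H₂ (m + 1)) + -(c * H (m + 1) ^ 2) * H m
        ≤ ∑ k ∈ Finset.Icc 1 m, Rp k / ((m : ℝ) + 1 - k) := by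
      rw [← sum_affine_H_div_sub]
      refine sum_div_sub_le_sum_div_sub fun k _ hk => ?_
      rcases le_or_gt 40 k with hk40 | hk40
      · refine le_trans ?_ (ih k (by omega) hk40)
        nlinarith [mul_nonneg hc0.le (sq_nonneg (H k - H (m + 1)))]
      · refine le_trans ?_ (hnonneg k)
        have h2 := H_mono hk40.le
        have h3 : 2 * H k ≤ H (m + 1) := by linarith [H_forty_bounds.2]
        nlinarith [mul_nonneg (mul_nonneg hc0.le hh.le) (sub_nonneg.2 h3)]
    have hsum' := mul_le_mul_of_nonneg_left hsum (show 0 ≤ (1 - p) / H (m + 1) by positivity)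
    have hprev := mul_le_mul_of_nonneg_left (ih m (by omega) hm40) hp0
    have hHm : H m = H (m + 1) - 1 / ((m : ℝ) + 1) := by rw [H_succ]; ring
    have heq : (1 - p) / H (m + 1) * (2 * c * H (m + 1) * (H (m + 1) ^ 2 - H₂ (m + 1))
          + -(c * H (m + 1) ^ 2) * H m)
        = (1 - p) * c * (H (m + 1) ^ 2 - 2 * H₂ (m + 1)
          + H (m + 1) * (1 / ((m : ℝ) + 1))) := by
      rw [hHm]
      field_simp
      ring
    rw [heq] at hsum'
    rw [hrec m]
    have hx : 0 < 1 / ((m : ℝ) + 1) := by positivity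
    have hH2 := H₂_succ_le m
    have hloss : 2 * H (m + 1) * (1 / ((m : ℝ) + 1)) ≤ 48 / 100 := by
      rw [mul_one_div, div_le_iff₀ (by positivity)]
      nlinarith
    have hprev2 : H (m + 1) ^ 2 - 48 / 100 ≤ H m ^ 2 := by
      rw [hHm]
      nlinarith
    have hsum2 : H (m + 1) ^ 2 - 861 / 100
        ≤ H (m + 1) ^ 2 - 2 * H₂ (m + 1) + H (m + 1) * (1 / ((m : ℝ) + 1)) := by
      have := mul_pos hh hx
      linarith
    have hA := mul_le_mul_of_nonneg_left hprev2 (mul_nonneg hp0 hc0.le)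
    have hB := mul_le_mul_of_nonneg_left hsum2 (mul_nonneg hq.le hc0.le)
    linarith

end Recurrence

theorem stmt_19 (p : ℝ) (hp0 : 0 ≤ p) (hp1 : p < 1) (Rp : ℕ → ℝ) (hRp0 : Rp 0 = 0)
    (hrec : ∀ n : ℕ, 1 ≤ n →
      Rp n = 1 + p * Rp (n - 1) +
        ((1 - p) / H n) * ∑ k ∈ Finset.Icc 1 (n - 1), Rp k / ((n : ℝ) - (k : ℝ))) :
    ∀ n : ℕ, 40 ≤ n →
      ((400 / 3447 : ℝ) / (1 - (1808 / 1915 : ℝ) * p)) * H n ^ 2 ≤ Rp n ∧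
      Rp n ≤ ((5 / 7 : ℝ) / (1 - p)) * H n ^ 2 := by
  have hq : 0 < 1 - p := by linarith
  have hrec' : ∀ m : ℕ, Rp (m + 1) = 1 + p * Rp m +
      ((1 - p) / H (m + 1)) * ∑ k ∈ Finset.Icc 1 m, Rp k / ((m : ℝ) + 1 - k) := fun m => by
    simpa using hrec (m + 1) (by omega)
  intro n hn
  constructor
  · have hd : 0 < 1 - (1808 / 1915 : ℝ) * p := by linarith
    refine lower_bound_aux hp0 hp1 hRp0 hrec' (by positivity) ?_ n hn
    rw [div_mul_eq_mul_div, div_le_one hd]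
    linarith
  · refine (upper_bound_aux hp0 hp1 hRp0 hrec' n).trans ?_
    rw [div_mul_eq_mul_div (2 / 3), div_mul_eq_mul_div (5 / 7)]
    refine div_le_div_of_nonneg_right ?_ hq.le
    have h := H_mono hn
    nlinarith [H_forty_bounds.1]
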